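/- Let Z be a nonempty finite type, let α > 0 be a real number, and let p₁, p₂ be probability mass functions on Z with p₁(z) > 0 and p₂(z) > 0 for all z. Define Z_α = ∑_z p₁(z)^{1/(α+1)} · p₂(z)^{α/(α+1)} and q_α(z) = p₁(z)^{1/(α+1)} · p₂(z)^{α/(α+1)} / Z_α. Then the minimum value of the objective q ↦ KL(q ‖ p₁) + α · KL(q ‖ p₂) over probability mass functions q on Z, which is attained at q = q_α, equals −(α+1) · log Z_α, and this value is nonnegative. -/

import Mathlib

open Real BigOperators Finset

/-- Kullback–Leibler divergence between probability mass functions on a finite type,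
with the summand taken to be `0` whenever `q z = 0`. -/
noncomputable def KLfin {Z : Type*} [Fintype Z] (q p : Z → ℝ) : ℝ :=
  ∑ z, if q z = 0 then 0 else q z * Real.log (q z / p z)

theorem KLfin_self {Z : Type*} [Fintype Z] (q : Z → ℝ) : KLfin q q = 0 := by
  refine Finset.sum_eq_zero fun z _ => ?_
  split_ifs with h
  · rfl
  · rw [div_self h, Real.log_one, mul_zero]

/-- Gibbs' inequality. -/
theorem KLfin_nonneg {Z : Type*} [Fintype Z] {q p : Z → ℝ} (hq : ∀ z, 0 ≤ q z)
    (hp : ∀ z, 0 < p z) (hsum : ∑ z, p z ≤ ∑ z, q z) : 0 ≤ KLfin q p := by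
  calc 0 ≤ ∑ z, (q z - p z) := by rw [Finset.sum_sub_distrib]; linarith
    _ ≤ KLfin q p := by
      refine Finset.sum_le_sum fun z _ => ?_
      split_ifs with h
      · rw [h]; linarith [hp z]
      · have hlog := Real.one_sub_inv_le_log_of_pos
          (div_pos ((hq z).lt_of_ne' h) (hp z))
        calc q z - p z = q z * (1 - (q z / p z)⁻¹) := by field_simp
          _ ≤ q z * Real.log (q z / p z) := mul_le_mul_of_nonneg_left hlog (hq z)

/-- The weighted sum of divergences differs by a constant from the divergence to the
normalized geometric mixture. -/
theorem KLfin_add_mul_KLfin {Z : Type*} [Fintype Z] {α c : ℝ} (hα : α + 1 ≠ 0) (hc : c ≠ 0)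
    {p₁ p₂ q : Z → ℝ} (hp₁ : ∀ z, 0 < p₁ z) (hp₂ : ∀ z, 0 < p₂ z) (hq : ∑ z, q z = 1) :
    KLfin q p₁ + α * KLfin q p₂ =
      (α + 1) * KLfin q (fun z => p₁ z ^ (1 / (α + 1)) * p₂ z ^ (α / (α + 1)) / c)
        - (α + 1) * Real.log c := by
  have hconst : (α + 1) * Real.log c = ∑ z, q z * ((α + 1) * Real.log c) := by
    rw [← Finset.sum_mul, hq, one_mul]
  rw [hconst]
  simp only [KLfin, Finset.mul_sum]
  rw [← Finset.sum_add_distrib, ← Finset.sum_sub_distrib]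
  refine Finset.sum_congr rfl fun z _ => ?_
  split_ifs with h
  · simp [h]
  · have h₁ := Real.rpow_pos_of_pos (hp₁ z) (1 / (α + 1))
    have h₂ := Real.rpow_pos_of_pos (hp₂ z) (α / (α + 1))
    rw [Real.log_div h (hp₁ z).ne', Real.log_div h (hp₂ z).ne',
      Real.log_div h (div_ne_zero (mul_pos h₁ h₂).ne' hc),
      Real.log_div (mul_pos h₁ h₂).ne' hc, Real.log_mul h₁.ne' h₂.ne',
      Real.log_rpow (hp₁ z), Real.log_rpow (hp₂ z)]
    field_simp
    ring

/-- The minimum of `q ↦ KL(q ‖ p₁) + α · KL(q ‖ p₂)` over probability mass functions,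
attained at `q = q_α`, equals `−(α+1) · log Z_α`, and this value is nonnegative. -/
theorem weighted_KL_min_value
    {Z : Type*} [Fintype Z] [Nonempty Z] (α : ℝ) (hα : 0 < α)
    (p₁ p₂ : Z → ℝ) (hp₁ : ∀ z, 0 < p₁ z) (hp₂ : ∀ z, 0 < p₂ z)
    (hs₁ : ∑ z, p₁ z = 1) (hs₂ : ∑ z, p₂ z = 1)
    (Zα : ℝ) (hZα : Zα = ∑ z, p₁ z ^ (1 / (α + 1)) * p₂ z ^ (α / (α + 1)))
    (qα : Z → ℝ)
    (hqα : ∀ z, qα z = p₁ z ^ (1 / (α + 1)) * p₂ z ^ (α / (α + 1)) / Zα) :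
    KLfin qα p₁ + α * KLfin qα p₂ = -(α + 1) * Real.log Zα ∧
    (∀ q : Z → ℝ, (∀ z, 0 ≤ q z) → ∑ z, q z = 1 →
      KLfin q p₁ + α * KLfin q p₂ ≥ -(α + 1) * Real.log Zα) ∧
    0 ≤ -(α + 1) * Real.log Zα := by
  have hα1 : 0 < α + 1 := by linarith
  have hw : ∀ z, 0 < p₁ z ^ (1 / (α + 1)) * p₂ z ^ (α / (α + 1)) := fun z =>
    mul_pos (Real.rpow_pos_of_pos (hp₁ z) _) (Real.rpow_pos_of_pos (hp₂ z) _)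
  have hZ : 0 < Zα := hZα ▸ Finset.sum_pos (fun z _ => hw z) Finset.univ_nonempty
  have hqpos : ∀ z, 0 < qα z := fun z => hqα z ▸ div_pos (hw z) hZ
  have hqsum : ∑ z, qα z = 1 := by
    simp only [hqα]
    rw [← Finset.sum_div, ← hZα, div_self hZ.ne']
  have key : ∀ q : Z → ℝ, ∑ z, q z = 1 →
      KLfin q p₁ + α * KLfin q p₂ = (α + 1) * KLfin q qα - (α + 1) * Real.log Zα := by
    intro q hq
    rw [KLfin_add_mul_KLfin hα1.ne' hZ.ne' hp₁ hp₂ hq, ← funext hqα]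
  have hval : KLfin qα p₁ + α * KLfin qα p₂ = -(α + 1) * Real.log Zα := by
    rw [key qα hqsum, KLfin_self]
    ring
  refine ⟨hval, fun q hq hs => ?_, ?_⟩
  · have hgibbs := mul_nonneg hα1.le (KLfin_nonneg hq hqpos (hqsum.trans hs.symm).le)
    rw [key q hs]
    linarith
  · rw [← hval]
    exact add_nonneg
      (KLfin_nonneg (fun z => (hqpos z).le) hp₁ (hs₁.trans hqsum.symm).le)
      (mul_nonneg hα.le (KLfin_nonneg (fun z => (hqpos z).le) hp₂ (hs₂.trans hqsum.symm).le))
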